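/- The Jacobi algebra of a dimer model on a surface of genus at least 2 is never finitely generated as a module over its center; in particular it is never an order. Specifically, if A_Q were module-finite over its center, then so would be Â_Q = A_Q[ℓ^{-1}], but Â_Q/(ℓ - 1) is Morita equivalent to the group algebra of the fundamental group of a higher genus surface, which is not module-finite over its center. -/

import Mathlib

open scoped BigOperators

attribute [local instance] Classical.propDecidable

noncomputable section

/-- The underlying data of a (possibly infinite) dimer model: a quiver together with
two distinguished collections of cyclic paths (the positive and negative faces).
Lists of arrows are written in *algebra order*: `[a₁, …, aₖ]` represents the path
`a₁ ⋯ aₖ`, traversing `aₖ` first; so consecutive arrows satisfy `tl aᵢ = hd aᵢ₊₁`. -/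
structure DimerData where
  V : Type
  E : Type
  hd : E → V
  tl : E → V
  facesP : Set (List E)
  facesM : Set (List E)

namespace DimerData

variable (D : DimerData)

def faces : Set (List D.E) := D.facesP ∪ D.facesM

/-- `p` is a path (in algebra order). -/
def IsPath (p : List D.E) : Prop := p.Chain' fun a b => D.tl a = D.hd b

/-- `p` is a path with tail `v` and head `w`. -/
def PathFrom (v w : D.V) (p : List D.E) : Prop :=
  D.IsPath p ∧ (∀ a ∈ p.head?, D.hd a = w) ∧ (∀ a ∈ p.getLast?, D.tl a = v) ∧
    (p = [] → v = w)

/-- `c` is a nonempty cyclic path. -/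
def IsCyc (c : List D.E) : Prop :=
  D.IsPath c ∧ ∃ a ∈ c.head?, ∃ b ∈ c.getLast?, D.tl b = D.hd a

/-- `c` is a cyclic path based at the vertex `v`. -/
def CycAt (v : D.V) (c : List D.E) : Prop := D.IsCyc c ∧ ∀ a ∈ c.head?, D.hd a = v

/-- The axioms of a dimer model: the faces are cyclic paths of length at least 3,
the two sets of faces are disjoint, and every arrow occurs exactly once among the
positive faces and exactly once among the negative faces (uniqueness of the
splitting `s.1 ++ a :: s.2` expresses "exactly once in exactly one cycle"). -/
structure IsDimer : Prop where
  facesP_cyc : ∀ c ∈ D.facesP, D.IsCyc c ∧ 3 ≤ c.length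
  facesM_cyc : ∀ c ∈ D.facesM, D.IsCyc c ∧ 3 ≤ c.length
  disjoint : Disjoint D.facesP D.facesM
  arrowP : ∀ a : D.E, ∃! s : List D.E × List D.E, s.1 ++ a :: s.2 ∈ D.facesP
  arrowM : ∀ a : D.E, ∃! s : List D.E × List D.E, s.1 ++ a :: s.2 ∈ D.facesM

/-- `p` is the positive complement of the arrow `a`: `a * p` is (a rotation of)
a positive face, i.e. `r_a = p⁺ - p⁻` has `p⁺ = p`. -/
def PosComp (a : D.E) (p : List D.E) : Prop := ∃ c ∈ D.facesP, (a :: p) ~r c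

/-- `p` is the negative complement of the arrow `a`. -/
def NegComp (a : D.E) (p : List D.E) : Prop := ∃ c ∈ D.facesM, (a :: p) ~r c

/-- The Euler characteristic `#Q₀ - #Q₁ + #Q₂` of a dimer model. -/
def eulerChar : ℤ := (Nat.card D.V : ℤ) - Nat.card D.E + Nat.card ↥D.faces

/-- The homology 1-chain of a path: the multiplicity of each arrow. -/
def chain (p : List D.E) : D.E → ℤ := fun a => (p.count a : ℤ)

/-- The span of the boundaries of the faces (the image of `d : ℤ^{Q₂} → ℤ^{Q₁}`). -/
def bd2span : Submodule ℤ (D.E → ℤ) :=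
  Submodule.span ℤ {x | ∃ c ∈ D.faces, x = D.chain c}

/-- The number of arrows of a path lying in a given set of arrows (the degree of
the path for the grading induced by a perfect matching). -/
def pdeg (P : Set D.E) (p : List D.E) : ℕ := p.countP fun a => decide (a ∈ P)

/-- A perfect matching: a set of arrows meeting every face exactly once. -/
def IsPM (P : Set D.E) : Prop := ∀ c ∈ D.faces, D.pdeg P c = 1

/-- Combinatorial homotopy of paths: the congruence generated by the Jacobi
relations `p⁺ ∼ p⁻` together with contracting any face cycle to a trivial path.
Two directed paths in the dimer model are homotopic in the underlying surface
iff they are related by this relation. -/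
inductive Htp : List D.E → List D.E → Prop
  | refl (p) : Htp p p
  | symm {p q} : Htp p q → Htp q p
  | trans {p q r} : Htp p q → Htp q r → Htp p r
  | append {p p' q q'} : Htp p p' → Htp q q' → Htp (p ++ q) (p' ++ q')
  | jac {a p q} : D.PosComp a p → D.NegComp a q → Htp p q
  | face {c c'} : c ∈ D.faces → c' ~r c → Htp c' []

section Fin

variable [Fintype D.E]

/-- The boundary map `ℤ^{Q₁} → ℤ^{Q₀}`, `a ↦ h(a) - t(a)`. -/
def bd1 (x : D.E → ℤ) : D.V → ℤ := fun v =>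
  (∑ a : D.E, if D.hd a = v then x a else 0) - ∑ a : D.E, if D.tl a = v then x a else 0

/-- A consistent R-charge: positive, faces of total degree 2, and the vertex
condition `Σ_{h(a)=v} (1 - R_a) + Σ_{t(a)=v} (1 - R_a) = 2`. -/
def ConsistentR (R : D.E → ℝ) : Prop :=
  (∀ a : D.E, 0 < R a) ∧
  (∀ c ∈ D.faces, (c.map R).sum = 2) ∧
  (∀ v : D.V,
    (∑ a : D.E, if D.hd a = v then 1 - R a else 0) +
      (∑ a : D.E, if D.tl a = v then 1 - R a else 0) = 2)

end Fin

/-! ### The Jacobi algebra -/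

inductive Gen (D : DimerData) : Type
  | vert : D.V → Gen D
  | arr : D.E → Gen D

/-- The free algebra on the vertices and arrows. -/
abbrev pre := FreeAlgebra ℂ (Gen D)

def genV (v : D.V) : D.pre := FreeAlgebra.ι ℂ (Gen.vert v)
def genE (a : D.E) : D.pre := FreeAlgebra.ι ℂ (Gen.arr a)

/-- The element of the free algebra corresponding to a path (in algebra order). -/
def word (p : List D.E) : D.pre := (p.map D.genE).prod

section Alg

variable [Fintype D.V]

/-- The defining relations of the path algebra `ℂQ`: the vertices are a complete
set of orthogonal idempotents and arrows compose according to heads and tails. -/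
inductive PARel : D.pre → D.pre → Prop
  | vv (v : D.V) : PARel (D.genV v * D.genV v) (D.genV v)
  | vw (v w : D.V) (h : v ≠ w) : PARel (D.genV v * D.genV w) 0
  | unit : PARel (∑ v : D.V, D.genV v) 1
  | hd (a : D.E) : PARel (D.genV (D.hd a) * D.genE a) (D.genE a)
  | tl (a : D.E) : PARel (D.genE a * D.genV (D.tl a)) (D.genE a)

/-- The relations of the Jacobi algebra: path algebra relations together with
the relations `r_a = p⁺ - p⁻` for every arrow `a`. -/
inductive JRel : D.pre → D.pre → Prop
  | pa {x y} : D.PARel x y → JRel x y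
  | jac {a p q} : D.PosComp a p → D.NegComp a q → JRel (D.word p) (D.word q)

/-- The path algebra `ℂQ`. -/
abbrev PathAlg := RingQuot D.PARel

/-- The Jacobi algebra `A_Q` of the dimer model. -/
abbrev Jac := RingQuot D.JRel

def toJac : D.pre →+* D.Jac := RingQuot.mkRingHom D.JRel

/-- The element of the Jacobi algebra given by a (nonempty) path. -/
def pathE (p : List D.E) : D.Jac := D.toJac (D.word p)

/-- The idempotent of a vertex in the Jacobi algebra. -/
def vtx (v : D.V) : D.Jac := D.toJac (D.genV v)

/-- The element of a possibly trivial path with tail vertex `v`. -/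
def pathAt (v : D.V) (p : List D.E) : D.Jac := if p = [] then D.vtx v else D.pathE p

/-- `A_Q` is a cancellation algebra: `p a = q a → p = q` and `a p = a q → p = q`
for every arrow `a` and all paths `p`, `q` (with matching heads and tails). -/
def Cancellation : Prop :=
  ∀ (a : D.E) (p q : List D.E) (v : D.V),
    (D.PathFrom (D.hd a) v p → D.PathFrom (D.hd a) v q →
      D.pathAt (D.hd a) p * D.pathE [a] = D.pathAt (D.hd a) q * D.pathE [a] →
      D.pathAt (D.hd a) p = D.pathAt (D.hd a) q) ∧
    (D.PathFrom v (D.tl a) p → D.PathFrom v (D.tl a) q →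
      D.pathE [a] * D.pathAt v p = D.pathE [a] * D.pathAt v q →
      D.pathAt v p = D.pathAt v q)

/-- A choice, for every vertex, of a face cycle based at that vertex. -/
def CycChoice (c : D.V → List D.E) : Prop :=
  ∀ v : D.V, c v ∈ D.faces ∧ D.CycAt v (c v)

/-- The canonical central element `ℓ = Σ_v c_v` attached to a choice of cycles. -/
def ell (c : D.V → List D.E) : D.Jac := ∑ v : D.V, D.pathE (c v)

end Alg

end DimerData

namespace DimerData

variable {D : DimerData}

/-- `Walk v w p` says that `p` is a directed path (in algebra order) from `v` to `w`. -/
inductive Walk (D : DimerData) : D.V → D.V → List D.E → Prop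
  | nil (v : D.V) : Walk D v v []
  | cons {v : D.V} (a : D.E) {p : List D.E} : Walk D v (D.tl a) p → Walk D v (D.hd a) (a :: p)

namespace Walk

theorem eq_of_nil {v w : D.V} (h : D.Walk v w []) : v = w := by
  cases h
  rfl

theorem append {u v w : D.V} {p q : List D.E} (hq : D.Walk v w q) (hp : D.Walk u v p) :
    D.Walk u w (q ++ p) := by
  induction hq with
  | nil => exact hp
  | cons a _ ih => exact .cons a ih

theorem exists_of_append {v w : D.V} {p q : List D.E} (h : D.Walk v w (q ++ p)) :
    ∃ u, D.Walk v u p ∧ D.Walk u w q := by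
  induction q generalizing w with
  | nil => exact ⟨w, h, .nil w⟩
  | cons a q ih =>
    cases h with
    | cons _ h =>
      obtain ⟨u, h₁, h₂⟩ := ih h
      exact ⟨u, h₁, .cons a h₂⟩

theorem of_isPath {p : List D.E} {a b : D.E} (hp : D.IsPath p) (ha : a ∈ p.head?)
    (hb : b ∈ p.getLast?) : D.Walk (D.tl b) (D.hd a) p := by
  induction p generalizing a with
  | nil => simp at ha
  | cons e p ih =>
    obtain rfl : e = a := by simpa using ha
    refine .cons e ?_
    cases p with
    | nil =>
      obtain rfl : e = b := by simpa using hb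
      exact .nil _
    | cons f p =>
      have h := List.isChain_cons_cons.1 hp
      rw [h.1]
      exact ih h.2 (by simp) (by simpa using hb)

theorem of_isCyc {c : List D.E} (hc : D.IsCyc c) : ∃ v, D.Walk v v c := by
  obtain ⟨hp, a, ha, b, hb, hab⟩ := hc
  exact ⟨D.hd a, hab ▸ of_isPath hp ha hb⟩

/-- The complement of an arrow in a cyclic path runs from its head to its tail. -/
theorem of_isRotated {c p : List D.E} {a : D.E} (hc : D.IsCyc c) (h : (a :: p) ~r c) :
    D.Walk (D.hd a) (D.tl a) p := by
  obtain ⟨v, hv⟩ := of_isCyc hc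
  obtain ⟨n, rfl⟩ := h
  obtain ⟨x, y, hx, hy⟩ : ∃ x y, a :: p = x ++ y ∧ (a :: p).rotate n = y ++ x :=
    ⟨_, _, (List.take_append_drop (n % (a :: p).length) _).symm,
      List.rotate_eq_drop_append_take_mod⟩
  rw [hy] at hv
  obtain ⟨u, h₁, h₂⟩ := hv.exists_of_append
  have h := h₁.append h₂
  rw [← hx] at h
  cases h with
  | cons _ h => exact h

end Walk

namespace IsDimer

theorem isCyc (hD : D.IsDimer) {c : List D.E} (hc : c ∈ D.faces) : D.IsCyc c :=
  hc.elim (fun h => (hD.facesP_cyc c h).1) fun h => (hD.facesM_cyc c h).1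

theorem ne_nil (hD : D.IsDimer) {c : List D.E} (hc : c ∈ D.faces) : c ≠ [] := by
  obtain ⟨-, a, ha, -⟩ := hD.isCyc hc
  rintro rfl
  simp at ha

theorem exists_walk_reverse (hD : D.IsDimer) (a : D.E) : ∃ p, D.Walk (D.hd a) (D.tl a) p := by
  obtain ⟨⟨s, t⟩, hs, -⟩ := hD.arrowP a
  refine ⟨t ++ s, Walk.of_isRotated (hD.facesP_cyc _ hs).1 ?_⟩
  exact (List.isRotated_append (l := s) (l' := a :: t)).symm

theorem finite_faces [Fintype D.E] (hD : D.IsDimer) : D.faces.Finite := by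
  have key : ∀ S : Set (List D.E), S ⊆ D.faces →
      (∀ a, ∃! s : List D.E × List D.E, s.1 ++ a :: s.2 ∈ S) → S.Finite := by
    intro S hS h
    choose f hf hu using h
    refine (Set.finite_range fun a => (f a).1 ++ a :: (f a).2).subset fun c hc => ?_
    obtain ⟨a, t, rfl⟩ := List.exists_cons_of_ne_nil (hD.ne_nil (hS hc))
    refine ⟨a, ?_⟩
    have := hu a ([], t) hc
    simp [← this]
  exact (key _ Set.subset_union_left hD.arrowP).union (key _ Set.subset_union_right hD.arrowM)

end IsDimer

/-- The set of connected components of the quiver. -/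
def Comp (D : DimerData) : Type := Quot fun v w : D.V => ∃ a, D.tl a = v ∧ D.hd a = w

def comp (v : D.V) : D.Comp := Quot.mk _ v

theorem comp_hd (a : D.E) : comp (D.hd a) = comp (D.tl a) :=
  (Quot.sound ⟨a, rfl, rfl⟩).symm

theorem IsDimer.exists_walk (hD : D.IsDimer) {v w : D.V} (h : comp v = comp w) :
    ∃ p, D.Walk v w p := by
  suffices H : ∀ x y : D.V, Relation.EqvGen (fun v w : D.V => ∃ a, D.tl a = v ∧ D.hd a = w) x y →
      (∃ p, D.Walk x y p) ∧ ∃ p, D.Walk y x p from (H v w (Quot.eqvGen_exact h)).1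
  intro x y hxy
  induction hxy with
  | rel x y h =>
    obtain ⟨a, rfl, rfl⟩ := h
    exact ⟨⟨[a], .cons a (.nil _)⟩, hD.exists_walk_reverse a⟩
  | refl x => exact ⟨⟨[], .nil x⟩, [], .nil x⟩
  | symm x y _ ih => exact ⟨ih.2, ih.1⟩
  | trans x y z _ _ ih₁ ih₂ =>
    obtain ⟨⟨p, hp⟩, p', hp'⟩ := ih₁
    obtain ⟨⟨q, hq⟩, q', hq'⟩ := ih₂
    exact ⟨⟨_, hq.append hp⟩, _, hp'.append hq'⟩

theorem Walk.comp_eq {v w : D.V} {p : List D.E} (h : D.Walk v w p) :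
    comp w = comp v ∧ ∀ a ∈ p, comp (D.tl a) = comp v := by
  induction h with
  | nil => simp
  | cons a _ ih => simpa [comp_hd, ih.1] using ih.2

/-- If all loops at `v` fix `x`, then `x` extends to a section over the component of `v`. -/
theorem IsDimer.exists_section (hD : D.IsDimer) {G X : Type*} [Group G] [MulAction G X]
    (γ : D.E → G) (v : D.V) (x : X)
    (hx : ∀ p, D.Walk v v p → (p.map γ).prod • x = x) :
    ∃ s : D.V → X, ∀ a, comp (D.tl a) = comp v → γ a • s (D.tl a) = s (D.hd a) := by
  have hp : ∀ w, ∃ p, comp w = comp v → D.Walk v w p := fun w => by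
    by_cases h : comp w = comp v
    · exact (hD.exists_walk h.symm).imp fun _ hp _ => hp
    · exact ⟨[], fun h' => (h h').elim⟩
  choose p hp using hp
  refine ⟨fun w => ((p w).map γ).prod • x, fun a ha => ?_⟩
  have ha' : comp (D.hd a) = comp v := (comp_hd a).trans ha
  obtain ⟨q, hq⟩ := hD.exists_walk ha'
  have h₁ := hx _ (hq.append (.cons a (hp _ ha)))
  have h₂ := hx _ (hq.append (hp _ ha'))
  simpa [mul_smul] using h₁.trans h₂.symm

theorem IsDimer.exists_comp [Fintype D.V] [Fintype D.E] (hD : D.IsDimer) (hχ : D.eulerChar < 0) :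
    ∃ κ : D.Comp, Nat.card {v : D.V // comp v = κ} +
      Nat.card {c : D.faces // ∃ a ∈ c.1, comp (D.tl a) = κ} <
        Nat.card {a : D.E // comp (D.tl a) = κ} := by
  have := hD.finite_faces.to_subtype
  have : Finite D.Comp := Finite.of_surjective (comp (D := D)) Quot.mk_surjective
  have := Fintype.ofFinite D.Comp
  have hf : ∀ c : D.faces, ∃ κ : D.Comp, ∀ a ∈ c.1, comp (D.tl a) = κ := fun c => by
    obtain ⟨v, hv⟩ := Walk.of_isCyc (hD.isCyc c.2)
    exact ⟨_, hv.comp_eq.2⟩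
  choose f hf using hf
  have hcard : ∀ {α : Type} [Finite α] (g : α → D.Comp),
      Nat.card α = ∑ κ, Nat.card {x // g x = κ} := fun g => by
    rw [← Nat.card_sigma, Nat.card_congr (Equiv.sigmaFiberEquiv g)]
  have h : Nat.card D.V + Nat.card D.faces < Nat.card D.E := by
    unfold eulerChar at hχ
    lia
  rw [hcard (comp (D := D)), hcard f, hcard fun a => comp (D.tl a), ← Finset.sum_add_distrib] at h
  obtain ⟨κ, -, hκ⟩ := Finset.exists_lt_of_sum_lt h
  refine ⟨κ, lt_of_le_of_lt (Nat.add_le_add_left ?_ _) hκ⟩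
  refine Nat.card_le_card_of_injective (fun c => ⟨c.1, ?_⟩) fun c c' h => ?_
  · obtain ⟨a, ha, h⟩ := c.2
    exact (hf c.1 a ha).symm.trans h
  · exact Subtype.ext (Subtype.mk.inj h)

/-- The value at `0` of the composition along a path of the affine maps
`x ↦ exp (σ a) * x + d a`, as a linear functional of `d`. -/
def affVal (σ : D.E → ℝ) : List D.E → (D.E → ℝ) →ₗ[ℝ] ℝ
  | [] => 0
  | a :: p => LinearMap.proj a + Real.exp (σ a) • affVal σ p

theorem affVal_eq_zero (σ d : D.E → ℝ) {p : List D.E} (h : ∀ a ∈ p, d a = 0) :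
    affVal σ p d = 0 := by
  induction p with
  | nil => rfl
  | cons a p ih => simp_all [affVal]

/-- A component of negative Euler characteristic carries a twisted cocycle which is not a
coboundary. -/
theorem IsDimer.exists_cocycle [Fintype D.V] [Fintype D.E] (hD : D.IsDimer) {κ : D.Comp}
    (hκ : Nat.card {v : D.V // comp v = κ} +
      Nat.card {c : D.faces // ∃ a ∈ c.1, comp (D.tl a) = κ} <
        Nat.card {a : D.E // comp (D.tl a) = κ}) (σ : D.E → ℝ) :
    ∃ d : D.E → ℝ, (∀ c ∈ D.faces, affVal σ c d = 0) ∧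
      ¬ ∃ s : D.V → ℝ, ∀ a, comp (D.tl a) = κ →
        Real.exp (σ a) * s (D.tl a) + d a = s (D.hd a) := by
  have := hD.finite_faces.to_subtype
  have := Fintype.ofFinite {c : D.faces // ∃ a ∈ c.1, comp (D.tl a) = κ}
  let ext : ({a : D.E // comp (D.tl a) = κ} → ℝ) →ₗ[ℝ] D.E → ℝ :=
    Function.ExtendByZero.linearMap ℝ Subtype.val
  let Φ : ({a : D.E // comp (D.tl a) = κ} → ℝ) →ₗ[ℝ]
      {c : D.faces // ∃ a ∈ c.1, comp (D.tl a) = κ} → ℝ :=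
    LinearMap.pi fun c => affVal σ c.1.1 ∘ₗ ext
  let B : ({v : D.V // comp v = κ} → ℝ) →ₗ[ℝ] {a : D.E // comp (D.tl a) = κ} → ℝ :=
    LinearMap.pi fun a => LinearMap.proj ⟨D.hd a.1, (comp_hd _).trans a.2⟩ -
      Real.exp (σ a.1) • LinearMap.proj ⟨D.tl a.1, a.2⟩
  have hnot : ¬ LinearMap.ker Φ ≤ LinearMap.range B := fun hle => by
    have h₁ := Submodule.finrank_mono hle
    have h₂ := Φ.finrank_range_add_finrank_ker
    have h₃ := B.finrank_range_le
    have h₄ := (LinearMap.range Φ).finrank_le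
    simp only [Module.finrank_fintype_fun_eq_card, Nat.card_eq_fintype_card] at h₂ h₃ h₄ hκ
    lia
  obtain ⟨d, hd, hdB⟩ := SetLike.not_le_iff_exists.1 hnot
  have hext : ∀ a (h : comp (D.tl a) = κ), ext d a = d ⟨a, h⟩ := fun a h =>
    Subtype.val_injective.extend_apply d 0 ⟨a, h⟩
  refine ⟨ext d, fun c hc => ?_, ?_⟩
  · by_cases h : ∃ a ∈ c, comp (D.tl a) = κ
    · exact congrFun hd ⟨⟨c, hc⟩, h⟩
    · refine affVal_eq_zero _ _ fun a ha => Function.extend_apply' _ _ _ ?_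
      rintro ⟨b, rfl⟩
      exact h ⟨_, ha, b.2⟩
  · rintro ⟨s, hs⟩
    refine hdB ⟨fun v => s v.1, ?_⟩
    ext a
    have := hs a.1 a.2
    rw [hext a.1 a.2] at this
    simp only [B, LinearMap.pi_apply, LinearMap.sub_apply, LinearMap.smul_apply,
      LinearMap.proj_apply, smul_eq_mul, ← this]
    ring

/-- The affine permutation `x ↦ exp s * x + d` of the real line. -/
def affPerm (s d : ℝ) : Equiv.Perm ℝ where
  toFun x := Real.exp s * x + d
  invFun x := Real.exp (-s) * (x - d)
  left_inv x := by simp [← mul_assoc, ← Real.exp_add]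
  right_inv x := by simp [← mul_assoc, ← Real.exp_add]

theorem affPerm_prod_apply (σ d : D.E → ℝ) (p : List D.E) (x : ℝ) :
    (p.map fun a => affPerm (σ a) (d a)).prod x =
      Real.exp (p.map σ).sum * x + affVal σ p d := by
  induction p with
  | nil => simp [affVal]
  | cons a p ih =>
    rw [List.map_cons, List.prod_cons, Equiv.Perm.mul_apply, ih]
    simp only [affPerm, Equiv.coe_fn_mk, List.map_cons, List.sum_cons, Real.exp_add, affVal,
      LinearMap.add_apply, LinearMap.smul_apply, LinearMap.proj_apply, smul_eq_mul]
    ring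

theorem affVal_zero (d : D.E → ℝ) (p : List D.E) : affVal 0 p d = (p.map d).sum := by
  induction p with
  | nil => rfl
  | cons a p ih => simp [affVal, ih]

section Rep

variable {G X : Type} [Group G] [MulAction G X]

/-- The partial permutation operator sending `(v, x)` to `(w, g • x)` and killing the
other fibres. -/
def shift (v w : D.V) (g : G) : Module.End ℂ (D.V × X →₀ ℂ) :=
  Finsupp.linearCombination ℂ fun y =>
    if y.1 = v then Finsupp.single (w, g • y.2) 1 else 0

theorem shift_single (v w u : D.V) (g : G) (x : X) :
    shift v w g (Finsupp.single (u, x) (1 : ℂ)) =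
      if u = v then Finsupp.single (w, g • x) 1 else 0 := by
  simp [shift]

theorem shift_mul_shift (u v w : D.V) (g h : G) :
    (shift v w g * shift u v h : Module.End ℂ (D.V × X →₀ ℂ)) = shift u w (g * h) := by
  ext ⟨y, x⟩ : 2
  by_cases hy : y = u <;> simp [shift_single, hy, mul_smul]

theorem shift_mul_shift_of_ne {u v v' w : D.V} (hv : v ≠ v') (g h : G) :
    (shift v' w g * shift u v h : Module.End ℂ (D.V × X →₀ ℂ)) = 0 := by
  ext ⟨y, x⟩ : 2
  by_cases hy : y = u <;> simp [shift_single, hy, hv]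

theorem shift_apply_self (v w : D.V) (g : G) (m : D.V × X →₀ ℂ) (x : X) :
    shift v w g m (w, g • x) = m (v, x) := by
  induction m using Finsupp.induction_linear with
  | zero => simp
  | add f g hf hg => simp [hf, hg]
  | single y c =>
    obtain ⟨y, x'⟩ := y
    by_cases hy : y = v <;> simp [shift, hy, Finsupp.single_apply]

theorem shift_apply_of_ne {v w u : D.V} (hu : u ≠ w) (g : G) (m : D.V × X →₀ ℂ) (x : X) :
    shift v w g m (u, x) = 0 := by
  induction m using Finsupp.induction_linear with
  | zero => simp
  | add f g hf hg => simp [hf, hg]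
  | single y c =>
    by_cases hy : y.1 = v <;> simp [shift, hy, hu.symm]

/-- The action of the free algebra on the permutation module attached to `γ`. -/
def preRep (γ : D.E → G) : D.pre →ₐ[ℂ] Module.End ℂ (D.V × X →₀ ℂ) :=
  FreeAlgebra.lift ℂ fun
    | .vert v => shift v v (1 : G)
    | .arr a => shift (D.tl a) (D.hd a) (γ a)

theorem preRep_genV (γ : D.E → G) (v : D.V) :
    preRep (X := X) γ (D.genV v) = shift v v (1 : G) := by
  simp [preRep, genV]

theorem preRep_genE (γ : D.E → G) (a : D.E) :
    preRep (X := X) γ (D.genE a) = shift (D.tl a) (D.hd a) (γ a) := by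
  simp [preRep, genE]

theorem preRep_word (γ : D.E → G) {v w : D.V} {p : List D.E} (hp : D.Walk v w p) (h : p ≠ []) :
    preRep (X := X) γ (D.word p) = shift v w (p.map γ).prod := by
  induction hp with
  | nil => exact (h rfl).elim
  | @cons a p hp ih =>
    rcases eq_or_ne p [] with rfl | hne
    · obtain rfl := hp.eq_of_nil
      simp [word, preRep_genE]
    · have : D.word (a :: p) = D.genE a * D.word p := by simp [word]
      rw [this, map_mul, ih hne, preRep_genE, shift_mul_shift]
      simp

variable [Fintype D.V]

theorem IsDimer.preRep_eq (hD : D.IsDimer) {γ : D.E → G}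
    (hγ : ∀ c ∈ D.faces, (c.map γ).prod = 1) {x y : D.pre} (h : D.JRel x y) :
    preRep (X := X) γ x = preRep γ y := by
  have hcomp : ∀ {a : D.E} {p c : List D.E}, c ∈ D.faces → 3 ≤ c.length → (a :: p) ~r c →
      preRep (X := X) γ (D.word p) = shift (D.hd a) (D.tl a) (γ a)⁻¹ := by
    intro a p c hc hl hr
    rw [preRep_word γ (Walk.of_isRotated (hD.isCyc hc) hr)]
    · congr 1
      have h₁ : (a :: p).map γ ~r c.map γ := hr.map γ
      obtain ⟨n, hn⟩ := h₁.symm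
      have h₂ := List.prod_rotate_eq_one_of_prod_eq_one (hγ c hc) n
      rw [hn] at h₂
      exact eq_inv_of_mul_eq_one_right (by simpa using h₂)
    · rintro rfl
      simp [← hr.perm.length_eq] at hl
  cases h with
  | pa h =>
    cases h with
    | vv v => simp [preRep_genV, shift_mul_shift]
    | vw v w h => simp [preRep_genV, shift_mul_shift_of_ne h.symm]
    | unit =>
      rw [map_sum, map_one]
      ext ⟨u, x⟩ : 2
      simp [preRep_genV, shift_single]
    | hd a => simp [preRep_genV, preRep_genE, shift_mul_shift]
    | tl a => simp [preRep_genV, preRep_genE, shift_mul_shift]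
  | jac hp hq =>
    obtain ⟨c, hc, hr⟩ := hp
    obtain ⟨c', hc', hr'⟩ := hq
    rw [hcomp (.inl hc) (hD.facesP_cyc c hc).2 hr, hcomp (.inr hc') (hD.facesM_cyc c' hc').2 hr']

/-- The action of the Jacobi algebra on the permutation module of a flat `G`-connection. -/
def IsDimer.rep (hD : D.IsDimer) (γ : D.E → G) (hγ : ∀ c ∈ D.faces, (c.map γ).prod = 1) :
    D.Jac →+* Module.End ℂ (D.V × X →₀ ℂ) :=
  RingQuot.lift ⟨(preRep γ).toRingHom, fun _ _ h => hD.preRep_eq hγ h⟩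

theorem IsDimer.rep_toJac (hD : D.IsDimer) (γ : D.E → G) (hγ : ∀ c ∈ D.faces, (c.map γ).prod = 1)
    (x : D.pre) : hD.rep (X := X) γ hγ (D.toJac x) = preRep γ x :=
  RingQuot.lift_mkRingHom_apply _ _ _

theorem IsDimer.exists_rep_eq_shift (hD : D.IsDimer) (γ : D.E → G)
    (hγ : ∀ c ∈ D.faces, (c.map γ).prod = 1) {v w : D.V} {p : List D.E} (hp : D.Walk v w p) :
    ∃ α, hD.rep (X := X) γ hγ α = shift v w (p.map γ).prod := by
  rcases eq_or_ne p [] with rfl | h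
  · cases hp
    exact ⟨D.toJac (D.genV v), by simp [hD.rep_toJac, preRep_genV]⟩
  · exact ⟨D.toJac (D.word p), by rw [hD.rep_toJac, preRep_word γ hp h]⟩

/-- If a flat connection has a loop `g` fixing `x` with infinite orbits elsewhere, and a loop
moving `x`, then the Jacobi algebra is not module-finite over its center. -/
theorem IsDimer.not_module_finite (hD : D.IsDimer) (γ : D.E → G)
    (hγ : ∀ c ∈ D.faces, (c.map γ).prod = 1) {v : D.V} {p q : List D.E} (hp : D.Walk v v p)
    (hq : D.Walk v v q) {x : X} (hx : (p.map γ).prod • x = x)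
    (hinj : ∀ y : X, y ≠ x → Function.Injective fun n : ℕ => (p.map γ).prod ^ n • y)
    (hqx : (q.map γ).prod • x ≠ x) : ¬ Module.Finite (Subring.center D.Jac) D.Jac := by
  intro hfin
  obtain ⟨α, hα⟩ := hD.exists_rep_eq_shift (X := X) γ hγ hp
  obtain ⟨β, hβ⟩ := hD.exists_rep_eq_shift (X := X) γ hγ hq
  set g := (p.map γ).prod
  set ρ := hD.rep (X := X) γ hγ
  set δ : D.V × X →₀ ℂ := Finsupp.single (v, x) 1
  have hcent : ∀ z : Subring.center D.Jac, ∃ c : ℂ, ρ z δ = c • δ := by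
    intro z
    set m := ρ z δ
    have hm : shift v v g m = m := by
      have h := congrArg ρ (Subring.mem_center_iff.1 z.2 α)
      rw [map_mul, map_mul, hα] at h
      have h' := LinearMap.congr_fun h δ
      simpa only [Module.End.mul_apply, δ, shift_single, if_true, hx] using h'
    have hpow : ∀ (n : ℕ) y, m (v, g ^ n • y) = m (v, y) := by
      intro n y
      induction n with
      | zero => simp
      | succ n ih =>
        rw [pow_succ', mul_smul, ← ih, ← shift_apply_self v v g m (g ^ n • y), hm]
    refine ⟨m (v, x), Finsupp.ext fun ⟨u, y⟩ => ?_⟩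
    by_cases hu : u = v
    · subst hu
      by_cases hy : y = x
      · simp [δ, hy]
      · have : m (u, y) = 0 := by
          by_contra hne
          refine Set.infinite_of_injective_forall_mem (f := fun n : ℕ => (u, g ^ n • y))
            (s := (m.support : Set (D.V × X))) (fun i j hij => hinj y hy (Prod.ext_iff.1 hij).2)
            (fun n => ?_) m.support.finite_toSet
          simpa [hpow] using hne
        simp [this, δ, Ne.symm hy]
    · rw [← hm, shift_apply_of_ne hu]
      simp [δ, Ne.symm hu]
  obtain ⟨S, hS⟩ := hfin.fg_top
  have hsupp : ∀ a : D.Jac, ρ a δ ∈ Finsupp.supported ℂ ℂ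
      (⋃ b ∈ S, ((ρ b δ).support : Set (D.V × X))) := by
    intro a
    have ha : a ∈ Submodule.span (Subring.center D.Jac) (S : Set D.Jac) := hS ▸ Submodule.mem_top
    induction ha using Submodule.span_induction with
    | mem b hb =>
      exact (Finsupp.mem_supported _ _).2 (Set.subset_biUnion_of_mem (u := fun b =>
        ((ρ b δ).support : Set (D.V × X))) hb)
    | zero => simp
    | add a b _ _ ha hb => rw [map_add]; exact Submodule.add_mem _ ha hb
    | smul z a _ ha =>
      obtain ⟨c, hc⟩ := hcent z
      have h : ρ (z • a) δ = c • ρ a δ := by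
        have h' : z • a = a * z := (Subring.mem_center_iff.1 z.2 a).symm
        rw [h', map_mul, Module.End.mul_apply, hc, map_smul]
      rw [h]
      exact Submodule.smul_mem _ _ ha
  have horb : ∀ n : ℕ, ρ (α ^ n * β) δ =
      Finsupp.single (v, g ^ n • (q.map γ).prod • x) 1 := by
    intro n
    induction n with
    | zero => simp [hβ, δ, shift_single]
    | succ n ih =>
      rw [pow_succ', mul_assoc, map_mul, Module.End.mul_apply, ih, hα, shift_single, if_pos rfl,
        pow_succ', mul_smul]
  refine Set.infinite_of_injective_forall_mem
    (f := fun n : ℕ => (v, g ^ n • (q.map γ).prod • x))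
    (s := ⋃ b ∈ S, ((ρ b δ).support : Set (D.V × X)))
    (fun i j hij => hinj _ hqx (Prod.ext_iff.1 hij).2) (fun n => ?_)
    (S.finite_toSet.biUnion fun b _ => (ρ b δ).support.finite_toSet)
  have h := hsupp (α ^ n * β)
  rw [horb, Finsupp.mem_supported] at h
  exact h (by simp)

end Rep

theorem injective_pow_affine {g : Equiv.Perm ℝ} {μ x : ℝ} (hμ : 0 < μ) (hμ' : μ ≠ 1)
    (hg : ∀ y, g y - x = μ * (y - x)) {y : ℝ} (hy : y ≠ x) :
    Function.Injective fun n : ℕ => g ^ n • y := by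
  have h : ∀ n : ℕ, (g ^ n) y - x = μ ^ n * (y - x) := by
    intro n
    induction n with
    | zero => simp
    | succ n ih => rw [pow_succ', Equiv.Perm.mul_apply, hg, ih]; ring
  intro i j hij
  have hij' : (g ^ i) y = (g ^ j) y := hij
  have h' := h i
  rw [hij', h j] at h'
  exact (pow_right_injective₀ hμ hμ' (mul_right_cancel₀ (sub_ne_zero.2 hy) h')).symm

theorem IsDimer.not_module_finite_center [Fintype D.V] [Fintype D.E] (hD : D.IsDimer)
    (hχ : D.eulerChar < 0) : ¬ Module.Finite (Subring.center D.Jac) D.Jac := by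
  obtain ⟨κ, hκ⟩ := hD.exists_comp hχ
  obtain ⟨v, rfl⟩ : ∃ v, comp v = κ := Quot.exists_rep κ
  obtain ⟨ψ, hψ, hψ'⟩ := hD.exists_cocycle hκ 0
  obtain ⟨d, hd, hd'⟩ := hD.exists_cocycle hκ ψ
  obtain ⟨p, hp, hpψ⟩ : ∃ p, D.Walk v v p ∧ (p.map ψ).sum ≠ 0 := by
    by_contra! h
    refine hψ' (hD.exists_section (fun a => affPerm 0 (ψ a)) v (0 : ℝ) fun p hp => ?_)
    have := affPerm_prod_apply 0 ψ p 0
    rw [affVal_zero, h p hp] at this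
    simpa using this
  set μ := Real.exp (p.map ψ).sum with hμ
  have hμ1 : μ ≠ 1 := by simpa [hμ] using hpψ
  have hμ2 : 1 - μ ≠ 0 := sub_ne_zero.2 hμ1.symm
  set x := affVal ψ p d / (1 - μ) with hx
  have hfix : ∀ y, (p.map fun a => affPerm (ψ a) (d a)).prod y - x = μ * (y - x) := by
    intro y
    rw [affPerm_prod_apply, ← hμ, hx]
    field_simp
    ring
  obtain ⟨q, hq, hqx⟩ : ∃ q, D.Walk v v q ∧
      (q.map fun a => affPerm (ψ a) (d a)).prod • x ≠ x := by
    by_contra! h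
    exact hd' (hD.exists_section _ v x h)
  refine hD.not_module_finite (fun a => affPerm (ψ a) (d a)) (fun c hc => ?_) hp hq (x := x) ?_
    (fun y hy => injective_pow_affine (Real.exp_pos _) hμ1 hfix hy) hqx
  · ext y
    rw [affPerm_prod_apply, hd c hc, ← affVal_zero, hψ c hc]
    simp
  · have := hfix x
    simpa [sub_eq_zero] using this

end DimerData

open DimerData in
/-- The Jacobi algebra of a dimer model on a surface of genus
at least two (negative Euler characteristic) is never a finitely generated
module over its center; in particular it is never an order. -/
theorem not_module_finite_higher_genus (D : DimerData) [Fintype D.V] [Fintype D.E]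
    (hD : D.IsDimer) (hχ : D.eulerChar < 0) :
    ¬ Module.Finite (Subring.center D.Jac) D.Jac ∧
    ¬ ((∀ x y : D.Jac, (∀ z : D.Jac, x * z * y = 0) → x = 0 ∨ y = 0) ∧
        Module.Finite (Subring.center D.Jac) D.Jac) := by
  have h := hD.not_module_finite_center hχ
  exact ⟨h, fun h' => h h'.2⟩
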